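/- Let Δ_q be the universal Askey–Wilson algebra over a field F with q ≠ 0, q⁴ ≠ 1, and let Ĥ_q be the universal DAHA of type (C₁∨, C₁). Then there exists a unique F-algebra homomorphism ψ : Δ_q → Ĥ_q with ψ(A) = t₁t₀ + (t₁t₀)⁻¹, ψ(B) = t₃t₀ + (t₃t₀)⁻¹, ψ(C) = t₂t₀ + (t₂t₀)⁻¹. -/

import Mathlib

noncomputable section

open FreeAlgebra

/-- `awδ q x y z = x + (q x y - q⁻¹ z y)/(q² - q⁻²)`, the generic expression required to be
central in the universal Askey–Wilson algebra. -/
def awδ {F : Type*} [Field F] (q : F) (x y z : FreeAlgebra F (Fin 3)) :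
    FreeAlgebra F (Fin 3) :=
  x + (q ^ 2 - q⁻¹ ^ 2)⁻¹ • (q • (y * z) - q⁻¹ • (z * y))

/-- Defining relations of the universal Askey–Wilson algebra: each of the three
elements `awδ` built from the generators `A, B, C` commutes with every generator. -/
inductive AWRel (F : Type*) [Field F] (q : F) :
    FreeAlgebra F (Fin 3) → FreeAlgebra F (Fin 3) → Prop
  | centralA (g : Fin 3) :
      AWRel F q (awδ q (ι F 0) (ι F 1) (ι F 2) * ι F g)
        (ι F g * awδ q (ι F 0) (ι F 1) (ι F 2))
  | centralB (g : Fin 3) :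
      AWRel F q (awδ q (ι F 1) (ι F 2) (ι F 0) * ι F g)
        (ι F g * awδ q (ι F 1) (ι F 2) (ι F 0))
  | centralC (g : Fin 3) :
      AWRel F q (awδ q (ι F 2) (ι F 0) (ι F 1) * ι F g)
        (ι F g * awδ q (ι F 2) (ι F 0) (ι F 1))

/-- The universal Askey–Wilson algebra `Δ_q`. -/
abbrev AW (F : Type*) [Field F] (q : F) := RingQuot (AWRel F q)

/-- The generator `A` of `Δ_q`. -/
def AW.A {F : Type*} [Field F] (q : F) : AW F q := RingQuot.mkAlgHom F (AWRel F q) (ι F 0)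

/-- The generator `B` of `Δ_q`. -/
def AW.B {F : Type*} [Field F] (q : F) : AW F q := RingQuot.mkAlgHom F (AWRel F q) (ι F 1)

/-- The generator `C` of `Δ_q`. -/
def AW.C {F : Type*} [Field F] (q : F) : AW F q := RingQuot.mkAlgHom F (AWRel F q) (ι F 2)

/-- The central element `α = (q + q⁻¹)(A + (qBC - q⁻¹CB)/(q² - q⁻²))` of `Δ_q`. -/
def AW.alpha {F : Type*} [Field F] (q : F) : AW F q :=
  (q + q⁻¹) • (AW.A q +
    (q ^ 2 - q⁻¹ ^ 2)⁻¹ • (q • (AW.B q * AW.C q) - q⁻¹ • (AW.C q * AW.B q)))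

/-- The central element `β = (q + q⁻¹)(B + (qCA - q⁻¹AC)/(q² - q⁻²))` of `Δ_q`. -/
def AW.beta {F : Type*} [Field F] (q : F) : AW F q :=
  (q + q⁻¹) • (AW.B q +
    (q ^ 2 - q⁻¹ ^ 2)⁻¹ • (q • (AW.C q * AW.A q) - q⁻¹ • (AW.A q * AW.C q)))

/-- The central element `γ = (q + q⁻¹)(C + (qAB - q⁻¹BA)/(q² - q⁻²))` of `Δ_q`. -/
def AW.gamma {F : Type*} [Field F] (q : F) : AW F q :=
  (q + q⁻¹) • (AW.C q +
    (q ^ 2 - q⁻¹ ^ 2)⁻¹ • (q • (AW.A q * AW.B q) - q⁻¹ • (AW.B q * AW.A q)))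

noncomputable section

open FreeAlgebra

/-- Defining relations of the universal DAHA of type `(C₁∨, C₁)`.
Generators: `(i, false)` is `tᵢ`, `(i, true)` is `tᵢ⁻¹`. -/
inductive DAHARel (F : Type*) [Field F] (q : F) :
    FreeAlgebra F (Fin 4 × Bool) → FreeAlgebra F (Fin 4 × Bool) → Prop
  | invRight (i : Fin 4) : DAHARel F q (ι F (i, false) * ι F (i, true)) 1
  | invLeft (i : Fin 4) : DAHARel F q (ι F (i, true) * ι F (i, false)) 1
  | central (i : Fin 4) (g : Fin 4 × Bool) :
      DAHARel F q ((ι F (i, false) + ι F (i, true)) * ι F g)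
        (ι F g * (ι F (i, false) + ι F (i, true)))
  | prodRel : DAHARel F q
      (ι F ((0 : Fin 4), false) * ι F ((1 : Fin 4), false) * ι F ((2 : Fin 4), false) *
        ι F ((3 : Fin 4), false))
      (algebraMap F (FreeAlgebra F (Fin 4 × Bool)) q⁻¹)

/-- The universal DAHA of type `(C₁∨, C₁)`. -/
abbrev DAHA (F : Type*) [Field F] (q : F) := RingQuot (DAHARel F q)

/-- The generator `tᵢ` of the universal DAHA. -/
def DAHA.t {F : Type*} [Field F] (q : F) (i : Fin 4) : DAHA F q :=
  RingQuot.mkAlgHom F (DAHARel F q) (ι F (i, false))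

/-- The generator `tᵢ⁻¹` of the universal DAHA. -/
def DAHA.tInv {F : Type*} [Field F] (q : F) (i : Fin 4) : DAHA F q :=
  RingQuot.mkAlgHom F (DAHARel F q) (ι F (i, true))

/-- `X = t₃ t₀`. -/
def DAHA.X {F : Type*} [Field F] (q : F) : DAHA F q := DAHA.t q 3 * DAHA.t q 0

/-- `X⁻¹ = t₀⁻¹ t₃⁻¹`. -/
def DAHA.Xinv {F : Type*} [Field F] (q : F) : DAHA F q := DAHA.tInv q 0 * DAHA.tInv q 3

/-- `Y = t₀ t₁`. -/
def DAHA.Y {F : Type*} [Field F] (q : F) : DAHA F q := DAHA.t q 0 * DAHA.t q 1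

/-- `Y⁻¹ = t₁⁻¹ t₀⁻¹`. -/
def DAHA.Yinv {F : Type*} [Field F] (q : F) : DAHA F q := DAHA.tInv q 1 * DAHA.tInv q 0

/-- `Tᵢ = tᵢ + tᵢ⁻¹`. -/
def DAHA.T {F : Type*} [Field F] (q : F) (i : Fin 4) : DAHA F q := DAHA.t q i + DAHA.tInv q i

section UnitPairs

variable {R : Type*} [Ring R]

/-- The element `s t + (s t)⁻¹` attached to two units `s`, `t` of a ring. -/
def pairTrace (t s : Rˣ) : R := s * t + (↑t⁻¹ * ↑s⁻¹ : R)

/-- The unit `s` has central trace `s + s⁻¹`. -/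
def HasCentralTrace (s : Rˣ) : Prop := ∀ x : R, Commute ((s : R) + ↑s⁻¹) x

lemma HasCentralTrace.conj_add_conj_inv {s : Rˣ} (hs : HasCentralTrace s) (t : Rˣ) :
    (↑(t * s * t⁻¹) : R) + ↑(t * s * t⁻¹)⁻¹ = s + ↑s⁻¹ := by
  have h := (hs (t : R)).eq
  calc (↑(t * s * t⁻¹) : R) + ↑(t * s * t⁻¹)⁻¹ = t * (s + ↑s⁻¹) * ↑t⁻¹ := by
        simp [mul_add, add_mul, mul_assoc]
    _ = s + ↑s⁻¹ := by rw [← h, mul_assoc, Units.mul_inv, mul_one]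

lemma HasCentralTrace.conj {s : Rˣ} (hs : HasCentralTrace s) (t : Rˣ) :
    HasCentralTrace (t * s * t⁻¹) := fun x => by
  rw [hs.conj_add_conj_inv]
  exact hs x

lemma pairTrace_swap {t s : Rˣ} (ht : HasCentralTrace t) (hs : HasCentralTrace s) :
    pairTrace t s = pairTrace s t := by
  have h1 := (ht (s : R)).eq
  have h2 := (hs (↑t⁻¹ : R)).eq
  rw [add_mul, mul_add] at h1 h2
  have h3 : (s * t : R) = t * s + ↑t⁻¹ * s - s * ↑t⁻¹ := by rw [h1]; abel
  have h4 : (↑t⁻¹ * ↑s⁻¹ : R) = s * ↑t⁻¹ + ↑s⁻¹ * ↑t⁻¹ - ↑t⁻¹ * s := by rw [h2]; abel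
  unfold pairTrace
  rw [h3, h4]
  abel

lemma pairTrace_conj {t s : Rˣ} (ht : HasCentralTrace t) (hs : HasCentralTrace s) :
    pairTrace t (t * s * t⁻¹) = pairTrace t s := by
  rw [pairTrace_swap ht hs]
  simp [pairTrace, mul_assoc]

lemma commute_pairTrace {t s : Rˣ} (ht : HasCentralTrace t) (hs : HasCentralTrace s) :
    Commute (t : R) (pairTrace t s) := by
  have h : (t : R) * pairTrace t s = pairTrace s t * t := by
    simp [pairTrace, mul_add, add_mul, mul_assoc]
  rwa [← pairTrace_swap ht hs] at h

end UnitPairs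

section AskeyWilsonRelation

variable {F R : Type*} [Field F] [Ring R] [Algebra F R]

lemma q_comm_pairTrace {q : F} (hq0 : q ≠ 0) {t u v w : Rˣ}
    (ht : HasCentralTrace t) (hu : HasCentralTrace u) (hv : HasCentralTrace v)
    (hw : HasCentralTrace w) (h : (t * u * v * w : R) = algebraMap F R q⁻¹) :
    q • (pairTrace t w * pairTrace t v) - q⁻¹ • (pairTrace t v * pairTrace t w) =
      (q - q⁻¹) • ((q⁻¹ • (t : R) + q • (↑t⁻¹ : R)) * (u + ↑u⁻¹) +
        (v + ↑v⁻¹) * (w + ↑w⁻¹)) - (q ^ 2 - q⁻¹ ^ 2) • pairTrace t u := by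
  have hvq : (v : R) = q⁻¹ • (↑u⁻¹ * ↑t⁻¹ * ↑w⁻¹ : R) := by
    have h1 : (v : R) = ↑u⁻¹ * (↑t⁻¹ * (t * u * v * w)) * ↑w⁻¹ := by simp [mul_assoc]
    rw [h1, h, Algebra.algebraMap_eq_smul_one]
    simp [mul_assoc]
  have hvi : (↑v⁻¹ : R) = q • (w * t * u : R) := by
    rw [Units.inv_eq_of_mul_eq_one_right]
    rw [hvq]
    simp [mul_assoc, smul_smul, hq0]
  obtain ⟨y, hy⟩ : ∃ y, y = t * u * t⁻¹ := ⟨_, rfl⟩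
  have hyt : (y * t : R) = t * u := by simp [hy, mul_assoc]
  have hty : (↑t⁻¹ * y : R) = u * ↑t⁻¹ := by simp [hy, mul_assoc]
  have hty' : (↑t⁻¹ * ↑y⁻¹ : R) = ↑u⁻¹ * ↑t⁻¹ := by simp [hy, mul_assoc]
  have hyU : (y : R) + ↑y⁻¹ = u + ↑u⁻¹ := by rw [hy, hu.conj_add_conj_inv]
  obtain ⟨U, hU⟩ : ∃ U, U = (u : R) + ↑u⁻¹ := ⟨_, rfl⟩
  obtain ⟨W, hW⟩ : ∃ W, W = (w : R) + ↑w⁻¹ := ⟨_, rfl⟩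
  have hUc : ∀ x, U * x = x * U := fun x => hU ▸ (hu x).eq
  have hWc : ∀ x, W * x = x * W := fun x => hW ▸ (hw x).eq
  have hui : (↑u⁻¹ : R) = U - u := by rw [hU]; abel
  have hyi : (↑y⁻¹ : R) = U - y := by rw [hU, ← hyU]; abel
  have hwi : (↑w⁻¹ : R) = W - w := by rw [hW]; abel
  obtain ⟨C, hCv⟩ : ∃ C, C = pairTrace t v := ⟨_, rfl⟩
  have hC : C = q⁻¹ • (↑y⁻¹ * ↑w⁻¹ : R) + q • (w * y : R) := by
    rw [hCv, pairTrace_swap ht hv]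
    simp only [pairTrace, hvi, hvq, hy]
    simp [mul_assoc]
  have hCt : (t : R) * C = C * t := hCv ▸ (commute_pairTrace ht hv).eq
  have hCt' : C * ↑t⁻¹ = ↑t⁻¹ * C := by
    rw [Units.eq_inv_mul_iff_mul_eq, ← mul_assoc, hCt, mul_assoc, Units.mul_inv, mul_one]
  have hwyw : (w * ↑y⁻¹ * ↑w⁻¹ : R) = U - W * (w * y) + w * y * w := by
    have h1 : (w * U * ↑w⁻¹ : R) = U := by rw [← hUc, mul_assoc, Units.mul_inv, mul_one]
    calc (w * ↑y⁻¹ * ↑w⁻¹ : R) = w * U * ↑w⁻¹ - w * y * ↑w⁻¹ := by rw [hyi]; noncomm_ring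
      _ = U - W * (w * y) + w * y * w := by rw [h1, hwi, hWc]; noncomm_ring
  have hwwy : (w * w * y : R) = W * (w * y) - y := by
    have h1 : ((W - w) * w : R) = 1 := by rw [← hwi, Units.inv_mul]
    calc (w * w * y : R) = W * (w * y) - (W - w) * w * y := by noncomm_ring
      _ = W * (w * y) - y := by rw [h1, one_mul]
  obtain ⟨K, hKdef⟩ : ∃ K, K = q • (w * C : R) - q⁻¹ • (C * w : R) := ⟨_, rfl⟩
  have hK : K = (1 - q⁻¹ ^ 2) • U - (q ^ 2 - q⁻¹ ^ 2) • (y : R) +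
      (q ^ 2 - 1) • (W * (w * y)) := by
    have h1 : (w * C : R) = q⁻¹ • (w * ↑y⁻¹ * ↑w⁻¹ : R) + q • (w * w * y : R) := by
      simp [hC, mul_add, mul_assoc]
    have h2 : (C * w : R) = q⁻¹ • (↑y⁻¹ : R) + q • (w * y * w : R) := by
      simp [hC, add_mul, mul_assoc]
    rw [hKdef, h1, h2, hwyw, hwwy, hyi]
    match_scalars <;> field_simp <;> ring
  have hBC : q • (pairTrace t w * C) - q⁻¹ • (C * pairTrace t w) =
      K * t - ↑t⁻¹ * K + (q - q⁻¹) • (↑t⁻¹ * (W * C)) := by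
    have h1 : pairTrace t w * C = w * C * t + ↑t⁻¹ * (W * C - w * C) := by
      rw [← sub_mul, ← hwi, pairTrace, add_mul, mul_assoc, hCt]
      noncomm_ring
    have h2 : C * pairTrace t w = C * w * t + ↑t⁻¹ * (W * C - C * w) := by
      rw [hWc, ← mul_sub, ← hwi, pairTrace, mul_add, ← mul_assoc, ← mul_assoc, ← mul_assoc,
        hCt']
    rw [h1, h2, hKdef]
    simp only [mul_sub, sub_mul, mul_smul_comm, smul_mul_assoc]
    module
  have hKt : K * t = (1 - q⁻¹ ^ 2) • (t * U) - (q ^ 2 - q⁻¹ ^ 2) • (t * u : R) +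
      (q ^ 2 - 1) • (W * (w * t * u)) := by
    rw [hK]
    simp only [add_mul, sub_mul, smul_mul_assoc, mul_assoc, hyt, hUc]
  have htK : ↑t⁻¹ * K = (1 - q⁻¹ ^ 2) • (↑t⁻¹ * U) - (q ^ 2 - q⁻¹ ^ 2) • (u * ↑t⁻¹ : R) +
      (q ^ 2 - 1) • (W * (↑t⁻¹ * w * y)) := by
    rw [hK]
    simp only [mul_add, mul_sub, mul_smul_comm, hty]
    rw [← mul_assoc (↑t⁻¹ : R) W, ← hWc]
    simp only [mul_assoc]
  have htC : ↑t⁻¹ * (W * C) = q⁻¹ • (W * (↑u⁻¹ * ↑t⁻¹ * ↑w⁻¹)) +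
      q • (W * (↑t⁻¹ * w * y)) := by
    rw [← mul_assoc, ← hWc, mul_assoc, hC]
    simp only [mul_add, mul_smul_comm]
    rw [← mul_assoc (↑t⁻¹ : R) (↑y⁻¹ : R), hty']
    simp only [mul_assoc]
  have hA : pairTrace t u = t * u + ↑t⁻¹ * U - u * ↑t⁻¹ := by
    rw [pairTrace_swap ht hu, pairTrace, hui, sub_mul, hUc]
    abel
  have hVW : (v + ↑v⁻¹ : R) * W =
      q⁻¹ • (W * (↑u⁻¹ * ↑t⁻¹ * ↑w⁻¹)) + q • (W * (w * t * u)) := by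
    rw [← hWc, hvi, hvq, mul_add, mul_smul_comm, mul_smul_comm]
  rw [← hCv, hBC, hKt, htK, htC, ← hU, ← hW, hVW, hA]
  simp only [add_mul, smul_mul_assoc]
  match_scalars <;> field_simp <;> ring

lemma commute_alpha {q : F} (hq0 : q ≠ 0) (hq4 : q ^ 4 ≠ 1) {t u v w : Rˣ}
    (ht : HasCentralTrace t) (hu : HasCentralTrace u) (hv : HasCentralTrace v)
    (hw : HasCentralTrace w) (h : (t * u * v * w : R) = algebraMap F R q⁻¹) {x : R}
    (hx : Commute (t : R) x) :
    Commute (pairTrace t u + (q ^ 2 - q⁻¹ ^ 2)⁻¹ •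
      (q • (pairTrace t w * pairTrace t v) - q⁻¹ • (pairTrace t v * pairTrace t w))) x := by
  have hq : q ^ 2 - q⁻¹ ^ 2 ≠ 0 := by
    intro h0
    apply hq4
    field_simp at h0
    linear_combination h0
  rw [q_comm_pairTrace hq0 ht hu hv hw h, smul_sub, inv_smul_smul₀ hq, add_sub_cancel]
  have hx' : Commute (↑t⁻¹ : R) x := hx.units_inv_left
  exact ((((hx.smul_left _).add_left (hx'.smul_left _)).mul_left (hu x)).add_left
    ((hv x).mul_left (hw x))).smul_left _ |>.smul_left _

end AskeyWilsonRelation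

section DAHA

variable {F : Type*} [Field F] (q : F)

/-- The generator `tᵢ` of the universal DAHA as a unit. -/
def DAHA.unit (i : Fin 4) : (DAHA F q)ˣ where
  val := DAHA.t q i
  inv := DAHA.tInv q i
  val_inv := by
    simpa [DAHA.t, DAHA.tInv] using RingQuot.mkAlgHom_rel F (DAHARel.invRight (F := F) (q := q) i)
  inv_val := by
    simpa [DAHA.t, DAHA.tInv] using RingQuot.mkAlgHom_rel F (DAHARel.invLeft (F := F) (q := q) i)

lemma DAHA.hasCentralTrace_unit (i : Fin 4) : HasCentralTrace (DAHA.unit q i) := by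
  intro x
  obtain ⟨p, rfl⟩ := RingQuot.mkAlgHom_surjective F (DAHARel F q) x
  have hsum : ((DAHA.unit q i : DAHA F q) + ↑(DAHA.unit q i)⁻¹) =
      RingQuot.mkAlgHom F (DAHARel F q) (ι F (i, false) + ι F (i, true)) := by
    rw [map_add]
    rfl
  rw [hsum]
  induction p using FreeAlgebra.induction with
  | grade0 r =>
    rw [AlgHom.commutes]
    exact Algebra.commutes' r _ |>.symm
  | grade1 g =>
    have h := RingQuot.mkAlgHom_rel F (DAHARel.central (F := F) (q := q) i g)
    rwa [map_mul, map_mul] at h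
  | mul a b ha hb =>
    rw [map_mul]
    exact ha.mul_right hb
  | add a b ha hb =>
    rw [map_add _ a b]
    exact ha.add_right hb

lemma DAHA.unit_mul_unit_mul_unit_mul_unit :
    (DAHA.unit q 0 * DAHA.unit q 1 * DAHA.unit q 2 * DAHA.unit q 3 : DAHA F q) =
      algebraMap F (DAHA F q) q⁻¹ := by
  have h := RingQuot.mkAlgHom_rel F (DAHARel.prodRel (F := F) (q := q))
  rw [AlgHom.commutes, map_mul, map_mul, map_mul] at h
  exact h

/-- The images of the generators `A`, `B`, `C` of `Δ_q` in the universal DAHA. -/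
def DAHA.awGen : Fin 3 → DAHA F q :=
  ![pairTrace (DAHA.unit q 0) (DAHA.unit q 1), pairTrace (DAHA.unit q 0) (DAHA.unit q 3),
    pairTrace (DAHA.unit q 0) (DAHA.unit q 2)]

lemma DAHA.commute_awGen (g : Fin 3) : Commute (DAHA.unit q 0 : DAHA F q) (DAHA.awGen q g) := by
  have h := fun i => commute_pairTrace (DAHA.hasCentralTrace_unit q 0)
    (DAHA.hasCentralTrace_unit q i)
  fin_cases g
  exacts [h 1, h 3, h 2]

lemma DAHA.lift_awGen_rel {q : F} (hq0 : q ≠ 0) (hq4 : q ^ 4 ≠ 1)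
    ⦃a b : FreeAlgebra F (Fin 3)⦄ (hab : AWRel F q a b) :
    FreeAlgebra.lift F (DAHA.awGen q) a = FreeAlgebra.lift F (DAHA.awGen q) b := by
  have hc := DAHA.hasCentralTrace_unit q
  have hprod := DAHA.unit_mul_unit_mul_unit_mul_unit q
  have hrot : ∀ a b : (DAHA F q)ˣ, (a * b : DAHA F q) = algebraMap F (DAHA F q) q⁻¹ →
      (b * a : DAHA F q) = algebraMap F (DAHA F q) q⁻¹ := by
    intro a b h
    have h1 : (b * a : DAHA F q) = ↑a⁻¹ * (a * b) * a := by simp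
    rw [h1, h, ← Algebra.commutes, mul_assoc, Units.inv_mul, mul_one]
  have h1 := hrot (DAHA.unit q 0 * DAHA.unit q 1) (DAHA.unit q 2 * DAHA.unit q 3)
    (by simpa [mul_assoc] using hprod)
  have h2 := hrot (DAHA.unit q 0 * DAHA.unit q 1 * DAHA.unit q 2) (DAHA.unit q 3)
    (by simpa [mul_assoc] using hprod)
  cases hab with
  | centralA g =>
    have h := commute_alpha hq0 hq4 (hc 0) (hc 1) (hc 2) (hc 3) hprod (DAHA.commute_awGen q g)
    simpa [awδ, DAHA.awGen] using h.eq
  | centralB g =>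
    have hB : (DAHA.unit q 0 * DAHA.unit q 3 *
        ↑(DAHA.unit q 0 * DAHA.unit q 1 * (DAHA.unit q 0)⁻¹) *
        ↑(DAHA.unit q 0 * DAHA.unit q 2 * (DAHA.unit q 0)⁻¹) : DAHA F q) =
          algebraMap F (DAHA F q) q⁻¹ := by
      have := hrot (DAHA.unit q 3 * DAHA.unit q 0 * DAHA.unit q 1 * DAHA.unit q 2 *
        (DAHA.unit q 0)⁻¹) (DAHA.unit q 0) (by simpa [mul_assoc] using h2)
      simpa [mul_assoc] using this
    have h := commute_alpha hq0 hq4 (hc 0) (hc 3) ((hc 1).conj (DAHA.unit q 0))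
      ((hc 2).conj (DAHA.unit q 0)) hB
      (DAHA.commute_awGen q g)
    rw [pairTrace_conj (hc 0) (hc 1), pairTrace_conj (hc 0) (hc 2)] at h
    simpa [awδ, DAHA.awGen] using h.eq
  | centralC g =>
    have hC : (DAHA.unit q 0 * DAHA.unit q 2 * DAHA.unit q 3 *
        ↑(DAHA.unit q 0 * DAHA.unit q 1 * (DAHA.unit q 0)⁻¹) : DAHA F q) =
          algebraMap F (DAHA F q) q⁻¹ := by
      have := hrot (DAHA.unit q 2 * DAHA.unit q 3 * DAHA.unit q 0 * DAHA.unit q 1 *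
        (DAHA.unit q 0)⁻¹) (DAHA.unit q 0) (by simpa [mul_assoc] using h1)
      simpa [mul_assoc] using this
    have h := commute_alpha hq0 hq4 (hc 0) (hc 2) (hc 3) ((hc 1).conj (DAHA.unit q 0)) hC
      (DAHA.commute_awGen q g)
    rw [pairTrace_conj (hc 0) (hc 1)] at h
    simpa [awδ, DAHA.awGen] using h.eq

end DAHA

/-- There is a unique `F`-algebra homomorphism `ψ : Δ_q → Ĥ_q` with
`ψ(A) = t₁t₀ + (t₁t₀)⁻¹`, `ψ(B) = t₃t₀ + (t₃t₀)⁻¹`, `ψ(C) = t₂t₀ + (t₂t₀)⁻¹`. -/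
theorem stmt_14 (F : Type*) [Field F] (q : F) (hq0 : q ≠ 0) (hq4 : q ^ 4 ≠ 1) :
    ∃! ψ : AW F q →ₐ[F] DAHA F q,
      ψ (AW.A q) = DAHA.t q 1 * DAHA.t q 0 + DAHA.tInv q 0 * DAHA.tInv q 1 ∧
      ψ (AW.B q) = DAHA.t q 3 * DAHA.t q 0 + DAHA.tInv q 0 * DAHA.tInv q 3 ∧
      ψ (AW.C q) = DAHA.t q 2 * DAHA.t q 0 + DAHA.tInv q 0 * DAHA.tInv q 2 := by
  refine ⟨RingQuot.liftAlgHom F ⟨FreeAlgebra.lift F (DAHA.awGen q),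
    DAHA.lift_awGen_rel hq0 hq4⟩, ⟨?_, ?_, ?_⟩, ?_⟩
  · rw [AW.A, RingQuot.liftAlgHom_mkAlgHom_apply, FreeAlgebra.lift_ι_apply]
    rfl
  · rw [AW.B, RingQuot.liftAlgHom_mkAlgHom_apply, FreeAlgebra.lift_ι_apply]
    rfl
  · rw [AW.C, RingQuot.liftAlgHom_mkAlgHom_apply, FreeAlgebra.lift_ι_apply]
    rfl
  · rintro φ ⟨hA, hB, hC⟩
    apply RingQuot.ringQuot_ext'
    apply FreeAlgebra.hom_ext
    funext g
    simp only [Function.comp_apply, AlgHom.comp_apply, RingQuot.liftAlgHom_mkAlgHom_apply,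
      FreeAlgebra.lift_ι_apply]
    fin_cases g
    exacts [hA, hB, hC]
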